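/- Let Σ be a real symmetric positive definite d×d matrix, Σ̂ a real symmetric positive semidefinite d×d matrix, λ > 0, 0 ≤ r ≤ 1/2, C ≥ 0, b ≥ 0, γ ≥ 0, and 0 ≤ c̃ < 1/2 with ‖(Σ + λI)^{-1/2}·(Σ − Σ̂)·(Σ + λI)^{-1/2}‖ ≤ c̃. Let θ* ∈ ℝ^d satisfy ‖Σ^{-r}·θ*‖₂ ≤ C, and let g : ℝ → ℝ satisfy, for every eigenvalue σ of Σ̂, |g(σ)·σ| ≤ b and |1 − g(σ)·σ|·σ^{1/2+r} ≤ γ·λ^{1/2+r}. Then ‖(Σ + λI)^{1/2}·(g(Σ̂)·Σ̂·θ* − θ*)‖₂ ≤ 2^{1/2+r}·C·(1/(1 − c̃))^{r+1/2}·(γ + b + 1)·λ^{1/2+r}. -/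

import Mathlib

open Matrix MeasureTheory

/-- The operator norm of a real `d × d` matrix induced by the Euclidean norm on `ℝ^d`. -/
noncomputable def opNorm {d : ℕ} (A : Matrix (Fin d) (Fin d) ℝ) : ℝ :=
  ‖Matrix.toEuclideanCLM (𝕜 := ℝ) A‖

/-- The Euclidean norm `‖x‖₂` of a vector `x ∈ ℝ^d`. -/
noncomputable def enorm2 {d : ℕ} (x : Fin d → ℝ) : ℝ :=
  Real.sqrt (∑ i, x i ^ 2)

/-- Apply a scalar function to the eigenvalues of a symmetric matrix (continuous
functional calculus); junk value `0` if the matrix is not symmetric. -/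
noncomputable def matFun {d : ℕ} (A : Matrix (Fin d) (Fin d) ℝ) (h : ℝ → ℝ) :
    Matrix (Fin d) (Fin d) ℝ :=
  if hA : A.IsHermitian then
    (hA.eigenvectorUnitary : Matrix (Fin d) (Fin d) ℝ) *
      Matrix.diagonal (fun i => h (hA.eigenvalues i)) *
      star (hA.eigenvectorUnitary : Matrix (Fin d) (Fin d) ℝ)
  else 0

/-- The entrywise inclusion of real matrices into complex matrices. -/
noncomputable def complexification (n : Type*) [Fintype n] [DecidableEq n] :
    Matrix n n ℝ →⋆ₐ[ℝ] Matrix n n ℂ :=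
  { Complex.ofRealAm.mapMatrix with
    map_star' := fun A => by
      ext i j
      simp [Matrix.star_apply] }

section

variable {n : Type*} [Fintype n] [DecidableEq n]

lemma complexification_apply (A : Matrix n n ℝ) (i j : n) :
    complexification n A i j = (A i j : ℂ) := rfl

open scoped MatrixOrder ComplexOrder

lemma complexification_nonneg_iff {A : Matrix n n ℝ} : 0 ≤ complexification n A ↔ 0 ≤ A := by
  constructor
  · intro h
    rw [Matrix.nonneg_iff_posSemidef] at h ⊢
    refine .of_dotProduct_mulVec_nonneg ?_ fun x => ?_
    · ext i j
      have := congrFun (congrFun h.1 i) j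
      simpa [complexification_apply] using this
    · have := h.dotProduct_mulVec_nonneg (fun i => (x i : ℂ))
      have e : star (fun i => (x i : ℂ)) ⬝ᵥ (complexification n A *ᵥ fun i => (x i : ℂ)) =
          ((star x ⬝ᵥ A *ᵥ x : ℝ) : ℂ) := by
        simp [dotProduct, mulVec, complexification_apply]
      rw [e] at this
      exact_mod_cast this
  · intro h
    obtain ⟨B, rfl⟩ := CStarAlgebra.nonneg_iff_eq_star_mul_self.mp h
    rw [map_mul, map_star]
    exact star_mul_self_nonneg _

lemma complexification_le_iff {A B : Matrix n n ℝ} :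
    complexification n A ≤ complexification n B ↔ A ≤ B := by
  rw [← sub_nonneg, ← map_sub, complexification_nonneg_iff, sub_nonneg]

lemma continuousOn_spectrum (A : Matrix n n ℝ) (f : ℝ → ℝ) : ContinuousOn f (spectrum ℝ A) :=
  A.finite_real_spectrum.continuousOn f

open scoped Matrix.Norms.L2Operator in
/-- The Löwner–Heinz inequality for real symmetric matrices. -/
lemma cfc_rpow_le_cfc_rpow {A B : Matrix n n ℝ} (hA : 0 ≤ A) (hAB : A ≤ B) {p : ℝ}
    (hp : p ∈ Set.Icc 0 1) : cfc (fun t : ℝ => t ^ p) A ≤ cfc (fun t : ℝ => t ^ p) B := by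
  have hB := hA.trans hAB
  have hc : Continuous (complexification n) :=
    (complexification n).toAlgHom.toLinearMap.continuous_of_finiteDimensional
  have key : ∀ M : Matrix n n ℝ, 0 ≤ M →
      complexification n (cfc (fun t : ℝ => t ^ p) M) = complexification n M ^ p := by
    intro M hM
    rw [CFC.rpow_eq_cfc_real (complexification_nonneg_iff.mpr hM)]
    exact StarAlgHom.map_cfc (complexification n) _ M (continuousOn_spectrum _ _) hc
      hM.isSelfAdjoint (complexification_nonneg_iff.mpr hM).isSelfAdjoint
  rw [← complexification_le_iff, key A hA, key B hB]
  exact CFC.rpow_le_rpow hp (complexification_le_iff.mpr hAB)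

end

lemma matFun_eq_cfc {d : ℕ} {A : Matrix (Fin d) (Fin d) ℝ} (hA : A.IsHermitian) (f : ℝ → ℝ) :
    matFun A f = cfc f A := by
  rw [hA.cfc_eq, matFun, dif_pos hA, Matrix.IsHermitian.cfc, Unitary.conjStarAlgAut_apply]
  rfl

section

variable {d : ℕ}

lemma enorm2_eq_norm (x : Fin d → ℝ) : enorm2 x = ‖WithLp.toLp 2 x‖ := by
  simp [enorm2, EuclideanSpace.norm_eq]

lemma enorm2_nonneg (x : Fin d → ℝ) : 0 ≤ enorm2 x := Real.sqrt_nonneg _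

lemma enorm2_sq (x : Fin d → ℝ) : enorm2 x ^ 2 = x ⬝ᵥ x := by
  rw [enorm2, Real.sq_sqrt (Finset.sum_nonneg fun i _ => sq_nonneg _)]
  simp [dotProduct, sq]

lemma dotProduct_le_enorm2_mul (x y : Fin d → ℝ) : x ⬝ᵥ y ≤ enorm2 x * enorm2 y := by
  have := real_inner_le_norm (WithLp.toLp 2 x) (WithLp.toLp 2 y)
  rwa [EuclideanSpace.inner_toLp_toLp, star_trivial, dotProduct_comm, ← enorm2_eq_norm,
    ← enorm2_eq_norm] at this

lemma enorm2_mulVec_le_opNorm (A : Matrix (Fin d) (Fin d) ℝ) (x : Fin d → ℝ) :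
    enorm2 (A *ᵥ x) ≤ opNorm A * enorm2 x := by
  rw [enorm2_eq_norm, enorm2_eq_norm, ← Matrix.toEuclideanCLM_toLp]
  exact ContinuousLinearMap.le_opNorm _ _

lemma dotProduct_mulVec_le_opNorm (A : Matrix (Fin d) (Fin d) ℝ) (x : Fin d → ℝ) :
    x ⬝ᵥ A *ᵥ x ≤ opNorm A * (x ⬝ᵥ x) := by
  rw [← enorm2_sq]
  nlinarith [dotProduct_le_enorm2_mul x (A *ᵥ x), enorm2_mulVec_le_opNorm A x, enorm2_nonneg x]

lemma enorm2_mulVec_sq (A : Matrix (Fin d) (Fin d) ℝ) (x : Fin d → ℝ) :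
    enorm2 (A *ᵥ x) ^ 2 = x ⬝ᵥ (star A * A) *ᵥ x := by
  rw [enorm2_sq, ← mulVec_mulVec, dotProduct_mulVec x, star_eq_conjTranspose,
    conjTranspose_eq_transpose_of_trivial, vecMul_transpose]

/-- A bound on a matrix as an operator passes to its transpose. -/
lemma enorm2_star_mulVec_le {A : Matrix (Fin d) (Fin d) ℝ} {k : ℝ}
    (h : ∀ x, enorm2 (A *ᵥ x) ≤ k * enorm2 x) (x : Fin d → ℝ) :
    enorm2 (star A *ᵥ x) ≤ k * enorm2 x := by
  set y := star A *ᵥ x with hy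
  have h1 : enorm2 y ^ 2 ≤ enorm2 x * (k * enorm2 y) := by
    have e : enorm2 y ^ 2 = x ⬝ᵥ A *ᵥ y := by
      rw [hy, enorm2_mulVec_sq, star_star, ← mulVec_mulVec]
    rw [e]
    exact (dotProduct_le_enorm2_mul _ _).trans
      (mul_le_mul_of_nonneg_left (h y) (enorm2_nonneg x))
  rcases (enorm2_nonneg y).eq_or_lt with h0 | h0
  · rw [← h0]
    exact (enorm2_nonneg _).trans (h x)
  · nlinarith

open scoped MatrixOrder

lemma dotProduct_mulVec_mono {A B : Matrix (Fin d) (Fin d) ℝ} (h : A ≤ B) (x : Fin d → ℝ) :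
    x ⬝ᵥ A *ᵥ x ≤ x ⬝ᵥ B *ᵥ x := by
  have := (Matrix.le_iff.mp h).dotProduct_mulVec_nonneg x
  rw [star_trivial, sub_mulVec, dotProduct_sub] at this
  linarith

lemma enorm2_mulVec_le_of_star_mul_self_le {A : Matrix (Fin d) (Fin d) ℝ} {k : ℝ} (hk : 0 ≤ k)
    (h : star A * A ≤ k ^ 2 • (1 : Matrix (Fin d) (Fin d) ℝ)) (x : Fin d → ℝ) :
    enorm2 (A *ᵥ x) ≤ k * enorm2 x := by
  refine le_of_sq_le_sq ?_ (mul_nonneg hk (enorm2_nonneg x))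
  rw [enorm2_mulVec_sq, mul_pow, enorm2_sq]
  refine (dotProduct_mulVec_mono h x).trans_eq ?_
  rw [smul_mulVec, one_mulVec, dotProduct_smul, smul_eq_mul]

lemma enorm2_cfc_mulVec_le {A : Matrix (Fin d) (Fin d) ℝ} (hA : A.IsHermitian) {f : ℝ → ℝ}
    {k : ℝ} (hk : 0 ≤ k) (hf : ∀ t ∈ spectrum ℝ A, |f t| ≤ k) (x : Fin d → ℝ) :
    enorm2 (cfc f A *ᵥ x) ≤ k * enorm2 x := by
  refine enorm2_mulVec_le_of_star_mul_self_le hk ?_ x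
  rw [(cfc_predicate f A : IsSelfAdjoint _).star_eq, ← cfc_mul f f A (continuousOn_spectrum _ _)
    (continuousOn_spectrum _ _), ← Algebra.algebraMap_eq_smul_one,
    ← cfc_const (k ^ 2) A hA.isSelfAdjoint]
  refine cfc_mono (fun t ht => ?_) (continuousOn_spectrum _ _) (continuousOn_spectrum _ _)
  have := sq_le_sq' (neg_le_of_abs_le (hf t ht)) (le_of_abs_le (hf t ht))
  linarith

/-- A form of the Cordes inequality: if `0 ≤ A ≤ k B` with `B = f(M)` positive definite, then
`‖B⁻ʳ Aʳ x‖ ≤ kʳ ‖x‖` for `0 ≤ r ≤ 1/2`. -/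
lemma enorm2_cfc_rpow_neg_mul_cfc_rpow_mulVec_le {A M : Matrix (Fin d) (Fin d) ℝ} (hA : 0 ≤ A)
    (hM : M.IsHermitian) {f : ℝ → ℝ} (hf : ∀ t ∈ spectrum ℝ M, 0 < f t) {k r : ℝ} (hk : 0 ≤ k)
    (hr0 : 0 ≤ r) (hr1 : r ≤ 1 / 2) (h : A ≤ cfc (fun t => k * f t) M) (x : Fin d → ℝ) :
    enorm2 ((cfc (fun t => f t ^ (-r)) M * cfc (fun t : ℝ => t ^ r) A) *ᵥ x) ≤
      k ^ r * enorm2 x := by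
  set H := cfc (fun t => f t ^ (-r)) M with hH
  set P := cfc (fun t : ℝ => t ^ r) A with hP
  have hHs : star H = H := (cfc_predicate _ M : IsSelfAdjoint _).star_eq
  have hPs : star P = P := (cfc_predicate _ A : IsSelfAdjoint _).star_eq
  have hPP : P * P = cfc (fun t : ℝ => t ^ (2 * r)) A := by
    rw [hP, ← cfc_mul _ _ A (continuousOn_spectrum _ _) (continuousOn_spectrum _ _)]
    refine cfc_congr fun t ht => ?_
    have ht0 := spectrum_nonneg_of_nonneg hA ht
    rw [two_mul, Real.rpow_add_of_nonneg ht0 hr0 hr0]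
  have key : star (P * H) * (P * H) ≤ (k ^ r) ^ 2 • (1 : Matrix (Fin d) (Fin d) ℝ) := by
    calc star (P * H) * (P * H) = star H * (P * P) * H := by
          rw [star_mul, hPs]; simp only [mul_assoc]
      _ ≤ star H * cfc (fun t => (k * f t) ^ (2 * r)) M * H := by
          refine star_left_conjugate_le_conjugate ?_ H
          rw [hPP, cfc_comp' (fun t : ℝ => t ^ (2 * r)) (fun t => k * f t) M
            ((M.finite_real_spectrum.image _).continuousOn _) (continuousOn_spectrum _ _)
            hM.isSelfAdjoint]
          exact cfc_rpow_le_cfc_rpow hA h ⟨by linarith, by linarith⟩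
      _ = (k ^ r) ^ 2 • (1 : Matrix (Fin d) (Fin d) ℝ) := by
          rw [hHs, hH, ← cfc_mul _ _ M (continuousOn_spectrum _ _) (continuousOn_spectrum _ _),
            ← cfc_mul _ _ M (continuousOn_spectrum _ _) (continuousOn_spectrum _ _),
            ← Algebra.algebraMap_eq_smul_one, ← cfc_const _ M hM.isSelfAdjoint]
          refine cfc_congr fun t ht => ?_
          have := hf t ht
          have h1 : f t ^ r ≠ 0 := (Real.rpow_pos_of_pos this r).ne'
          simp only [Real.mul_rpow hk this.le, two_mul, Real.rpow_neg this.le,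
            Real.rpow_add_of_nonneg hk hr0 hr0, Real.rpow_add_of_nonneg this.le hr0 hr0]
          field_simp
  have := enorm2_star_mulVec_le
    (enorm2_mulVec_le_of_star_mul_self_le (Real.rpow_nonneg hk r) key) x
  rwa [star_mul, hPs, hHs] at this

/-- Relative perturbation bound: `‖T^{-1/2} D T^{-1/2}‖ ≤ c` forces `⟨x, D x⟩ ≤ c ⟨x, T x⟩`. -/
lemma dotProduct_mulVec_le_of_opNorm_le {T D : Matrix (Fin d) (Fin d) ℝ} (hT : T.PosDef)
    {c : ℝ} (h : opNorm ((cfc Real.sqrt T)⁻¹ * D * (cfc Real.sqrt T)⁻¹) ≤ c) (x : Fin d → ℝ) :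
    x ⬝ᵥ D *ᵥ x ≤ c * (x ⬝ᵥ T *ᵥ x) := by
  set R := cfc Real.sqrt T with hR
  have hRs : star R = R := (cfc_predicate _ T : IsSelfAdjoint _).star_eq
  have hRR : R * R = T := by
    rw [hR, ← cfc_mul _ _ T (continuousOn_spectrum _ _) (continuousOn_spectrum _ _)]
    conv_rhs => rw [← cfc_id' ℝ T hT.1.isSelfAdjoint]
    exact cfc_congr fun t ht => Real.mul_self_sqrt
      (spectrum_nonneg_of_nonneg (Matrix.nonneg_iff_posSemidef.mpr hT.posSemidef) ht)
  have hdet : IsUnit R.det := by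
    have : T.det ≠ 0 := hT.det_pos.ne'
    rw [← hRR, det_mul] at this
    exact (left_ne_zero_of_mul this).isUnit
  have h1 := dotProduct_mulVec_le_opNorm (R⁻¹ * D * R⁻¹) (R *ᵥ x)
  have e1 : (R *ᵥ x) ⬝ᵥ (R⁻¹ * D * R⁻¹) *ᵥ (R *ᵥ x) = x ⬝ᵥ D *ᵥ x := by
    rw [mulVec_mulVec, mul_assoc, nonsing_inv_mul R hdet, mul_one]
    nth_rw 1 [← hRs]
    rw [star_eq_conjTranspose, conjTranspose_eq_transpose_of_trivial, mulVec_transpose,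
      ← dotProduct_mulVec, mulVec_mulVec, ← mul_assoc, mul_nonsing_inv R hdet, one_mul]
  have e2 : (R *ᵥ x) ⬝ᵥ (R *ᵥ x) = x ⬝ᵥ T *ᵥ x := by
    rw [← enorm2_sq, enorm2_mulVec_sq, hRs, hRR]
  rw [e1, e2] at h1
  exact h1.trans (mul_le_mul_of_nonneg_right h
    (by simpa using hT.posSemidef.dotProduct_mulVec_nonneg x))

end

/-- The residual of a spectral filter, weighted by a shifted power. -/
lemma abs_residual_mul_add_rpow_le {σ lam q b γ v : ℝ} (hσ : 0 ≤ σ) (hlam : 0 < lam) (hq0 : 0 ≤ q)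
    (hq1 : q ≤ 1) (h1 : |v| ≤ b) (h2 : |1 - v| * σ ^ q ≤ γ * lam ^ q) :
    |1 - v| * (σ + lam) ^ q ≤ (γ + b + 1) * lam ^ q := by
  have h3 := Real.rpow_add_le_add_rpow hσ hlam.le hq0 hq1
  have h4 : |1 - v| ≤ 1 + b := (abs_sub _ _).trans (by simpa using h1)
  have h5 := mul_le_mul_of_nonneg_right h4 (Real.rpow_nonneg hlam.le q)
  have h6 := mul_le_mul_of_nonneg_left h3 (abs_nonneg (1 - v))
  linarith

open scoped MatrixOrder

/-- Bias bound: if `Σ` is positive definite, `Σ̂` PSD, `λ > 0`,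
`0 ≤ r ≤ 1/2`, `‖Σ^{-r} θ*‖₂ ≤ C`, `‖(Σ+λI)^{-1/2}(Σ-Σ̂)(Σ+λI)^{-1/2}‖ ≤ c̃ < 1/2`, and
`g` satisfies `|g(σ)σ| ≤ b` and `|1-g(σ)σ|·σ^{1/2+r} ≤ γ λ^{1/2+r}` on the eigenvalues of `Σ̂`,
then `‖(Σ+λI)^{1/2}(g(Σ̂)Σ̂θ* - θ*)‖₂ ≤ 2^{1/2+r} C (1/(1-c̃))^{r+1/2} (γ+b+1) λ^{1/2+r}`. -/
theorem statement5 {d : ℕ} (hd : 0 < d) (S Shat : Matrix (Fin d) (Fin d) ℝ)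
    (hS : S.PosDef) (hShat : Shat.PosSemidef) (lam r C b γ c : ℝ)
    (hlam : 0 < lam) (hr0 : 0 ≤ r) (hr1 : r ≤ 1 / 2) (hC : 0 ≤ C) (hb : 0 ≤ b)
    (hγ : 0 ≤ γ) (hc0 : 0 ≤ c) (hc : c < 1 / 2)
    (h : opNorm ((matFun (S + lam • 1) Real.sqrt)⁻¹ * (S - Shat) *
        (matFun (S + lam • 1) Real.sqrt)⁻¹) ≤ c)
    (θ : Fin d → ℝ) (hθ : enorm2 ((matFun S (fun t => t ^ (-r))).mulVec θ) ≤ C)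
    (g : ℝ → ℝ)
    (hg1 : ∀ i : Fin d, |g (hShat.1.eigenvalues i) * hShat.1.eigenvalues i| ≤ b)
    (hg2 : ∀ i : Fin d,
      |1 - g (hShat.1.eigenvalues i) * hShat.1.eigenvalues i| *
        hShat.1.eigenvalues i ^ (1 / 2 + r) ≤ γ * lam ^ (1 / 2 + r)) :
    enorm2 ((matFun (S + lam • 1) Real.sqrt).mulVec
        ((matFun Shat g * Shat).mulVec θ - θ)) ≤
      (2 : ℝ) ^ ((1 : ℝ) / 2 + r) * C * (1 / (1 - c)) ^ (r + 1 / 2) * (γ + b + 1) *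
        lam ^ ((1 : ℝ) / 2 + r) := by

  have hSh := hS.posSemidef
  have hShat0 : (0 : Matrix (Fin d) (Fin d) ℝ) ≤ Shat :=
    Matrix.nonneg_iff_posSemidef.mpr hShat
  have hS0 : (0 : Matrix (Fin d) (Fin d) ℝ) ≤ S := Matrix.nonneg_iff_posSemidef.mpr hSh
  have hT : (S + lam • (1 : Matrix (Fin d) (Fin d) ℝ)).PosDef :=
    hS.add_posSemidef (Matrix.PosSemidef.one.smul hlam.le)
  rw [matFun_eq_cfc hT.1] at h ⊢
  rw [matFun_eq_cfc hS.1] at hθ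
  rw [matFun_eq_cfc hShat.1]
  set K := 1 / (1 - c) with hK
  have hc1 : 0 < 1 - c := by linarith
  have hK0 : 0 < K := by positivity
  have hpos : ∀ t ∈ spectrum ℝ Shat, 0 ≤ t := fun t ht => spectrum_nonneg_of_nonneg hShat0 ht
  have hposl : ∀ t ∈ spectrum ℝ Shat, 0 < t + lam := fun t ht => by linarith [hpos t ht]
  have hcont : ∀ f : ℝ → ℝ, ContinuousOn f (spectrum ℝ Shat) := continuousOn_spectrum Shat
  have hshift : cfc (fun t : ℝ => t + lam) Shat = Shat + lam • 1 := by
    rw [cfc_add_const lam (fun t => t) Shat (hcont _) hShat.1.isSelfAdjoint,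
      cfc_id' ℝ Shat hShat.1.isSelfAdjoint, Algebra.algebraMap_eq_smul_one]
  have hquad : ∀ x : Fin d → ℝ, x ⬝ᵥ (S + lam • (1 : Matrix (Fin d) (Fin d) ℝ)) *ᵥ x ≤
      K * (x ⬝ᵥ (Shat + lam • (1 : Matrix (Fin d) (Fin d) ℝ)) *ᵥ x) := by
    intro x
    have := dotProduct_mulVec_le_of_opNorm_le hT h x
    rw [hK, div_mul_eq_mul_div, one_mul, le_div_iff₀ hc1]
    simp only [add_mulVec, sub_mulVec, dotProduct_add, dotProduct_sub] at this ⊢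
    linarith
  have hle : S ≤ cfc (fun t : ℝ => K * (t + lam)) Shat := by
    rw [cfc_const_mul K (fun t : ℝ => t + lam) Shat (hcont _), hshift, Matrix.le_iff]
    refine .of_dotProduct_mulVec_nonneg ?_ fun x => ?_
    · refine Matrix.IsHermitian.sub ?_ hS.1
      rw [← hshift]
      exact (IsSelfAdjoint.all K).smul (cfc_predicate _ Shat)
    · have h1 := hquad x
      have h2 : 0 ≤ lam * (x ⬝ᵥ x) := by rw [← enorm2_sq]; positivity
      simp only [add_mulVec, sub_mulVec, smul_mulVec, one_mulVec, dotProduct_add, dotProduct_sub,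
        dotProduct_smul, smul_eq_mul, star_trivial] at h1 ⊢
      linarith
  set η := cfc (fun t : ℝ => t ^ (-r)) S *ᵥ θ with hη
  set w := (cfc (fun t : ℝ => (t + lam) ^ (-r)) Shat * cfc (fun t : ℝ => t ^ r) S) *ᵥ η with hw
  have hw_le : enorm2 w ≤ K ^ r * C :=
    (enorm2_cfc_rpow_neg_mul_cfc_rpow_mulVec_le hS0 hShat.1 hposl hK0.le hr0 hr1 hle η).trans
      (mul_le_mul_of_nonneg_left hθ (Real.rpow_nonneg hK0.le r))
  have hθη : cfc (fun t : ℝ => t ^ r) S *ᵥ η = θ := by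
    rw [hη, mulVec_mulVec, ← cfc_mul _ _ S (continuousOn_spectrum _ _) (continuousOn_spectrum _ _)]
    have : cfc (fun t : ℝ => t ^ r * t ^ (-r)) S = cfc (fun _ : ℝ => (1 : ℝ)) S := by
      refine cfc_congr fun t ht => ?_
      obtain ⟨i, rfl⟩ := hS.1.spectrum_real_eq_range_eigenvalues ▸ ht
      have := hS.eigenvalues_pos i
      simp only [Real.rpow_neg this.le]
      exact mul_inv_cancel₀ (Real.rpow_pos_of_pos this r).ne'
    rw [this, cfc_const_one ℝ S hS.1.isSelfAdjoint, one_mulVec]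
  have hwθ : cfc (fun t : ℝ => (t + lam) ^ r) Shat *ᵥ w = θ := by
    rw [hw, mulVec_mulVec, ← mul_assoc, ← cfc_mul _ _ Shat (hcont _) (hcont _)]
    have : cfc (fun t : ℝ => (t + lam) ^ r * (t + lam) ^ (-r)) Shat =
        cfc (fun _ : ℝ => (1 : ℝ)) Shat := by
      refine cfc_congr fun t ht => ?_
      simp only [Real.rpow_neg (hposl t ht).le]
      exact mul_inv_cancel₀ (Real.rpow_pos_of_pos (hposl t ht) r).ne'
    rw [this, cfc_const_one ℝ Shat hShat.1.isSelfAdjoint, one_mul, hθη]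
  set u := (cfc g Shat * Shat) *ᵥ θ - θ with hu
  have hu_eq : u = cfc (fun t : ℝ => g t * t - 1) Shat *ᵥ θ := by
    rw [cfc_sub (fun t => g t * t) (fun _ => 1) Shat (hcont _) (hcont _),
      cfc_mul g (fun t => t) Shat (hcont _) (hcont _), cfc_id' ℝ Shat hShat.1.isSelfAdjoint,
      cfc_const_one ℝ Shat hShat.1.isSelfAdjoint, sub_mulVec, one_mulVec]
  have hq : 0 ≤ (γ + b + 1) * lam ^ (1 / 2 + r) := by positivity
  have hhalf : enorm2 (cfc (fun t : ℝ => √(t + lam)) Shat *ᵥ u) ≤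
      (γ + b + 1) * lam ^ (1 / 2 + r) * enorm2 w := by
    rw [hu_eq, ← hwθ, mulVec_mulVec, mulVec_mulVec, ← cfc_mul _ _ Shat (hcont _) (hcont _),
      ← cfc_mul _ _ Shat (hcont _) (hcont _)]
    refine enorm2_cfc_mulVec_le hShat.1 hq (fun t ht => ?_) w
    have ht0 := hposl t ht
    have e : |√(t + lam) * (g t * t - 1) * (t + lam) ^ r| =
        |1 - g t * t| * (t + lam) ^ (1 / 2 + r) := by
      rw [Real.rpow_add ht0, ← Real.sqrt_eq_rpow, abs_mul, abs_mul, abs_sub_comm,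
        abs_of_nonneg (Real.sqrt_nonneg _), abs_of_nonneg (Real.rpow_nonneg ht0.le r)]
      ring
    rw [e]
    obtain ⟨i, rfl⟩ := hShat.1.spectrum_real_eq_range_eigenvalues ▸ ht
    exact abs_residual_mul_add_rpow_le (hpos _ ht) hlam (by linarith) (by linarith) (hg1 i) (hg2 i)
  have hsqrt : ∀ {A M : Matrix (Fin d) (Fin d) ℝ} {f : ℝ → ℝ}, M.IsHermitian →
      (∀ t ∈ spectrum ℝ M, 0 ≤ f t) → cfc f M = A →
      enorm2 (cfc (fun t => √(f t)) M *ᵥ u) ^ 2 = u ⬝ᵥ A *ᵥ u := by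
    intro A M f hM hf hA
    rw [enorm2_mulVec_sq, (cfc_predicate _ M : IsSelfAdjoint _).star_eq,
      ← cfc_mul _ _ M (continuousOn_spectrum _ _) (continuousOn_spectrum _ _), ← hA,
      cfc_congr fun t ht => Real.mul_self_sqrt (hf t ht)]
  have hmain : enorm2 (cfc Real.sqrt (S + lam • (1 : Matrix (Fin d) (Fin d) ℝ)) *ᵥ u) ≤
      √K * enorm2 (cfc (fun t : ℝ => √(t + lam)) Shat *ᵥ u) := by
    refine le_of_sq_le_sq ?_ (mul_nonneg (Real.sqrt_nonneg _) (enorm2_nonneg _))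
    rw [mul_pow, Real.sq_sqrt hK0.le, hsqrt hShat.1 (fun t ht => (hposl t ht).le) hshift,
      hsqrt hT.1 (fun t ht => spectrum_nonneg_of_nonneg
        (Matrix.nonneg_iff_posSemidef.mpr hT.posSemidef) ht) (cfc_id' ℝ _ hT.1.isSelfAdjoint)]
    exact hquad u
  have h2 : (1 : ℝ) ≤ 2 ^ ((1 : ℝ) / 2 + r) := Real.one_le_rpow (by norm_num) (by linarith)
  calc _ ≤ √K * ((γ + b + 1) * lam ^ (1 / 2 + r) * (K ^ r * C)) :=
        hmain.trans (mul_le_mul_of_nonneg_left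
          (hhalf.trans (mul_le_mul_of_nonneg_left hw_le hq)) (Real.sqrt_nonneg _))
    _ = 1 * (C * K ^ (r + 1 / 2) * (γ + b + 1) * lam ^ ((1 : ℝ) / 2 + r)) := by
        rw [Real.rpow_add hK0, ← Real.sqrt_eq_rpow]; ring
    _ ≤ 2 ^ ((1 : ℝ) / 2 + r) * (C * K ^ (r + 1 / 2) * (γ + b + 1) * lam ^ ((1 : ℝ) / 2 + r)) :=
        mul_le_mul_of_nonneg_right h2 (by positivity)
    _ = _ := by ring
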